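/- arXiv:2107.08965 — 2 statements merged into one kernel-verified Lean document; each statement's English description precedes it below -/
import Mathlib

section
/- Let O be a non-wasteful allocation and O* any allocation of all of G, with b_i = |O_i ∩ B_i| and b*_i = |O*_i ∩ B_i|. For every agent j with b*_j < b_j there exists an agent i such that either (1) in the transformation graph G_{O*→O} there is an SB-balancing path from i to j, or (2) b*_i > b_i and in G_{O*→O} there is a BB-balancing path from i to j. -/
open Finset

variable {N G : Type*}

/-- Agent `i`'s 2-value additive valuation of bundle `A`. -/
def twoVal [DecidableEq G] (Bset : N → Finset G) (v : ℚ) (i : N) (A : Finset G) : ℚ :=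
  ((A ∩ Bset i).card : ℚ) + v * ((A \ Bset i).card : ℚ)

/-- An allocation: pairwise disjoint bundles covering all of `G`. -/
def IsAllocation [Fintype N] [Fintype G] [DecidableEq G] (A : N → Finset G) : Prop :=
  (Set.univ : Set N).PairwiseDisjoint A ∧ Finset.univ.biUnion A = (Finset.univ : Finset G)

/-- A non-wasteful allocation. -/
def IsNonWasteful [Fintype N] [DecidableEq G] (Bset A : N → Finset G) : Prop :=
  (Set.univ : Set N).PairwiseDisjoint A ∧ (∀ i, A i ⊆ Bset i) ∧
    Finset.univ.biUnion A = Finset.univ.biUnion Bset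

/-- There is a BB-balancing path from `i` to `j` in the transformation graph `G_{Aa → Ab}`. -/
def ExistsBBPath [DecidableEq G] (Aa Ab Bset : N → Finset G) (i j : N) : Prop :=
  ∃ (k : ℕ) (hk : 1 ≤ k) (ag : Fin (k + 1) → N) (gd : Fin k → G),
    Function.Injective gd ∧ ag 0 = i ∧ ag (Fin.last k) = j ∧
    (∀ t : Fin k, gd t ∈ Aa (ag t.castSucc) ∧ gd t ∈ Ab (ag t.succ)) ∧
    (∀ t : Fin k, 1 ≤ t.val →
      (gd t ∈ Bset (ag t.castSucc) ↔
        gd ⟨t.val - 1, by have := t.isLt; omega⟩ ∈ Bset (ag t.castSucc))) ∧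
    gd ⟨0, by omega⟩ ∈ Bset i ∧ gd ⟨k - 1, by omega⟩ ∈ Bset j

/-- There is an SB-balancing path from `i` to `j` in the transformation graph `G_{Aa → Ab}`. -/
def ExistsSBPath [DecidableEq G] (Aa Ab Bset : N → Finset G) (i j : N) : Prop :=
  ∃ (k : ℕ) (hk : 1 ≤ k) (ag : Fin (k + 1) → N) (gd : Fin k → G),
    Function.Injective gd ∧ ag 0 = i ∧ ag (Fin.last k) = j ∧
    (∀ t : Fin k, gd t ∈ Aa (ag t.castSucc) ∧ gd t ∈ Ab (ag t.succ)) ∧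
    (∀ t : Fin k, 1 ≤ t.val →
      (gd t ∈ Bset (ag t.castSucc) ↔
        gd ⟨t.val - 1, by have := t.isLt; omega⟩ ∈ Bset (ag t.castSucc))) ∧
    gd ⟨0, by omega⟩ ∉ Bset i ∧ gd ⟨k - 1, by omega⟩ ∈ Bset j

/-- `ag 0, …, ag k` with goods `gd 0, …, gd (k - 1)` is a walk in the transformation graph
`G_{Aa → Ab}` whose agents after the first are distinct and each of whose interior agents gives
away a good that is big for them. -/
structure IsBigWalk (Aa Ab Bset : N → Finset G) (k : ℕ) (ag : ℕ → N) (gd : ℕ → G) : Prop where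
  mem_source : ∀ t < k, gd t ∈ Aa (ag t)
  mem_target : ∀ t < k, gd t ∈ Ab (ag (t + 1))
  big_of_pos : ∀ t < k, 1 ≤ t → gd t ∈ Bset (ag t)
  agent_inj : ∀ s < k, ∀ t < k, ag (s + 1) = ag (t + 1) → s = t

namespace IsBigWalk

variable {Aa Ab Bset : N → Finset G} {k : ℕ} {ag : ℕ → N} {gd : ℕ → G}

theorem good_injective (h : IsBigWalk Aa Ab Bset k ag gd)
    (hdisj : (Set.univ : Set N).PairwiseDisjoint Ab) :
    Function.Injective fun t : Fin k => gd t := by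
  intro s t hst
  have hs := h.mem_target s s.isLt
  have ht := h.mem_target t t.isLt
  simp only at hst
  rw [← hst] at ht
  refine Fin.ext (h.agent_inj s s.isLt t t.isLt ?_)
  by_contra hne
  exact Finset.disjoint_left.mp (hdisj (Set.mem_univ _) (Set.mem_univ _) hne) hs ht

theorem big_iff (h : IsBigWalk Aa Ab Bset k ag gd) (hsub : ∀ i, Ab i ⊆ Bset i)
    {t : ℕ} (ht : t < k) (hpos : 1 ≤ t) :
    gd t ∈ Bset (ag t) ↔ gd (t - 1) ∈ Bset (ag t) := by
  refine iff_of_true (h.big_of_pos t ht hpos) (hsub _ ?_)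
  have := h.mem_target (t - 1) (by omega)
  rwa [Nat.sub_add_cancel hpos] at this

theorem last_big (h : IsBigWalk Aa Ab Bset k ag gd) (hsub : ∀ i, Ab i ⊆ Bset i) (hk : 1 ≤ k) :
    gd (k - 1) ∈ Bset (ag k) := by
  have := h.mem_target (k - 1) (by omega)
  rw [Nat.sub_add_cancel hk] at this
  exact hsub _ this

theorem existsBBPath [DecidableEq G] (h : IsBigWalk Aa Ab Bset k ag gd)
    (hdisj : (Set.univ : Set N).PairwiseDisjoint Ab) (hsub : ∀ i, Ab i ⊆ Bset i) (hk : 1 ≤ k)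
    (h0 : gd 0 ∈ Bset (ag 0)) : ExistsBBPath Aa Ab Bset (ag 0) (ag k) :=
  ⟨k, hk, fun t => ag t, fun t => gd t, h.good_injective hdisj, rfl, rfl,
    fun t => ⟨h.mem_source t t.isLt, h.mem_target t t.isLt⟩,
    fun t ht => h.big_iff hsub t.isLt ht, h0, h.last_big hsub hk⟩

theorem existsSBPath [DecidableEq G] (h : IsBigWalk Aa Ab Bset k ag gd)
    (hdisj : (Set.univ : Set N).PairwiseDisjoint Ab) (hsub : ∀ i, Ab i ⊆ Bset i) (hk : 1 ≤ k)
    (h0 : gd 0 ∉ Bset (ag 0)) : ExistsSBPath Aa Ab Bset (ag 0) (ag k) :=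
  ⟨k, hk, fun t => ag t, fun t => gd t, h.good_injective hdisj, rfl, rfl,
    fun t => ⟨h.mem_source t t.isLt, h.mem_target t t.isLt⟩,
    fun t ht => h.big_iff hsub t.isLt ht, h0, h.last_big hsub hk⟩

end IsBigWalk

/-- Agent `i` reaches agent `j` by a (possibly trivial) simple path in `G_{Aa → Ab}` along which
every agent gives away a good that is big for them. -/
def BigReachable (Aa Ab Bset : N → Finset G) (j i : N) : Prop :=
  ∃ (k : ℕ) (ag : ℕ → N) (gd : ℕ → G), IsBigWalk Aa Ab Bset k ag gd ∧
    (∀ t < k, gd t ∈ Bset (ag t)) ∧ (∀ t < k, ag (t + 1) ≠ ag 0) ∧ ag 0 = i ∧ ag k = j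

namespace BigReachable

variable {Aa Ab Bset : N → Finset G} {j a b : N} {g : G}

theorem refl (g : G) : BigReachable Aa Ab Bset j j :=
  ⟨0, fun _ => j, fun _ => g, ⟨by simp, by simp, by simp, by simp⟩, by simp, by simp, rfl, rfl⟩

/-- An edge into an agent that reaches `j` extends to a walk starting with that edge. -/
theorem exists_walk_cons (h : BigReachable Aa Ab Bset j b) (ha : g ∈ Aa a) (hb : g ∈ Ab b) :
    ∃ (k : ℕ) (ag : ℕ → N) (gd : ℕ → G), IsBigWalk Aa Ab Bset (k + 1) ag gd ∧
      (∀ t < k, gd (t + 1) ∈ Bset (ag (t + 1))) ∧ ag 0 = a ∧ gd 0 = g ∧ ag (k + 1) = j := by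
  obtain ⟨k, ag, gd, hw, hbig, hne, rfl, rfl⟩ := h
  refine ⟨k, fun t => Nat.casesOn t a ag, fun t => Nat.casesOn t g gd,
    ⟨?_, ?_, ?_, ?_⟩, hbig, rfl, rfl, rfl⟩
  · rintro (_ | t) ht
    · exact ha
    · exact hw.mem_source t (by omega)
  · rintro (_ | t) ht
    · exact hb
    · exact hw.mem_target t (by omega)
  · rintro (_ | t) ht hpos
    · omega
    · exact hbig t (by omega)
  · rintro (_ | s) hs (_ | t) ht hst
    · rfl
    · exact absurd hst.symm (hne t (by omega))
    · exact absurd hst (hne s (by omega))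
    · exact congrArg (· + 1) (hw.agent_inj s (by omega) t (by omega) hst)

theorem cons (h : BigReachable Aa Ab Bset j b) (ha : g ∈ Aa a) (hb : g ∈ Ab b)
    (hg : g ∈ Bset a) : BigReachable Aa Ab Bset j a := by
  obtain ⟨k, ag, gd, hw, hbig, rfl, rfl, rfl⟩ := h.exists_walk_cons ha hb
  by_cases hmem : ∃ s < k + 1, ag (s + 1) = ag 0
  · obtain ⟨s, hs, hsa⟩ := hmem
    refine ⟨k - s, fun t => ag (t + (s + 1)), fun t => gd (t + (s + 1)),
      ⟨fun t ht => hw.mem_source _ (by omega), fun t ht => ?_,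
        fun t ht _ => hbig (t + s) (by omega), fun t ht u hu htu => ?_⟩,
      fun t ht => hbig (t + s) (by omega), fun t ht htu => ?_, ?_, ?_⟩
    · have := hw.mem_target (t + (s + 1)) (by omega)
      rwa [show t + (s + 1) + 1 = t + 1 + (s + 1) by omega] at this
    · have := hw.agent_inj (t + 1 + s) (by omega) (u + 1 + s) (by omega) htu
      omega
    · have := hw.agent_inj (t + 1 + s) (by omega) (0 + s) (by omega) htu
      omega
    · simpa using hsa
    · exact congrArg ag (by omega)
  · push Not at hmem
    refine ⟨k + 1, ag, gd, hw, ?_, hmem, rfl, rfl⟩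
    rintro (_ | t) ht
    · exact hg
    · exact hbig t (by omega)

end BigReachable

/-- Lemma 2.3: for every agent `j` with `b*_j < b_j` there is an agent `i` such that
either there is an SB-balancing path from `i` to `j` in `G_{O* → O}`, or `b*_i > b_i`
and there is a BB-balancing path from `i` to `j` in `G_{O* → O}`. -/
theorem stmt1 [Fintype N] [DecidableEq N] [Fintype G] [DecidableEq G]
    (Bset : N → Finset G) (v : ℚ) (hv0 : 0 < v) (hv1 : v < 1)
    (O Ostar : N → Finset G)
    (hO : IsNonWasteful Bset O) (hOstar : IsAllocation Ostar)
    (j : N) (hj : (Ostar j ∩ Bset j).card < (O j ∩ Bset j).card) :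
    ∃ i : N, ExistsSBPath Ostar O Bset i j ∨
      ((O i ∩ Bset i).card < (Ostar i ∩ Bset i).card ∧ ExistsBBPath Ostar O Bset i j) := by
  classical
  obtain ⟨hdisj, hsub, -⟩ := hO
  obtain ⟨hdisj', hcover⟩ := hOstar
  by_cases hSB : ∃ i, ExistsSBPath Ostar O Bset i j
  · obtain ⟨i, hi⟩ := hSB
    exact ⟨i, Or.inl hi⟩
  push Not at hSB
  obtain ⟨g₀, -⟩ := Finset.card_pos.mp (Nat.zero_lt_of_lt hj)
  let R : Finset N := univ.filter (BigReachable Ostar O Bset j)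
  have hjR : j ∈ R := by simpa [R] using BigReachable.refl g₀
  have hclosed : R.biUnion (fun i => O i ∩ Bset i) ⊆ R.biUnion fun i => Ostar i ∩ Bset i := by
    intro g hg
    obtain ⟨b, hb, hgb⟩ := Finset.mem_biUnion.mp hg
    have hb : BigReachable Ostar O Bset j b := by simpa [R] using hb
    have hgb : g ∈ O b := Finset.mem_of_mem_inter_left hgb
    obtain ⟨a, -, hga⟩ := Finset.mem_biUnion.mp (hcover ▸ Finset.mem_univ g)
    have hgB : g ∈ Bset a := by
      by_contra hgB
      obtain ⟨k, ag, gd, hw, -, rfl, rfl, rfl⟩ := hb.exists_walk_cons hga hgb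
      exact hSB _ (hw.existsSBPath hdisj hsub (by omega) hgB)
    exact Finset.mem_biUnion.mpr
      ⟨a, by simpa [R] using hb.cons hga hgb hgB, Finset.mem_inter.mpr ⟨hga, hgB⟩⟩
  have hcard := Finset.card_le_card hclosed
  have hinter : ∀ A : N → Finset G, (Set.univ : Set N).PairwiseDisjoint A →
      (R : Set N).PairwiseDisjoint fun i => A i ∩ Bset i := fun A hA =>
    (hA.subset (Set.subset_univ _)).mono fun _ => Finset.inter_subset_left
  rw [Finset.card_biUnion (hinter O hdisj), Finset.card_biUnion (hinter Ostar hdisj')] at hcard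
  obtain ⟨i, hiR, hi⟩ : ∃ i ∈ R, (O i ∩ Bset i).card < (Ostar i ∩ Bset i).card := by
    by_contra! hle
    exact absurd (Finset.sum_lt_sum hle ⟨j, hjR, hj⟩) (not_lt.mpr hcard)
  have hreach : BigReachable Ostar O Bset j i := by simpa [R] using hiR
  obtain ⟨k, ag, gd, hw, hbig, -, rfl, rfl⟩ := hreach
  have hk : 1 ≤ k := by
    rcases Nat.eq_zero_or_pos k with rfl | hk
    · exact absurd hi hj.asymm
    · exact hk
  exact ⟨ag 0, Or.inr ⟨hi, hw.existsBBPath hdisj hsub hk (hbig 0 hk)⟩⟩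
end

section
/- If there is an agent i with b_i < b*_i, then there exists an agent j with b*_j < b_j that is reachable from i by a BB-balancing path in the transformation graph G_{O*→O}; and every agent j with b*_j < b_j reachable from i by a BB-balancing path in G_{O*→O} has at least one good in O*_j that is small for j, i.e. O*_j \ B_j ≠ ∅. -/
open Finset

variable {N G : Type*}

/-- The Nash product of an allocation. -/
def nashProd [Fintype N] [DecidableEq G] (Bset : N → Finset G) (v : ℚ)
    (A : N → Finset G) : ℚ :=
  ∏ i, twoVal Bset v i (A i)

/-- `O` is an optimal allocation for the dichotomous instance: among non-wasteful
allocations it maximizes the number of agents with nonempty bundle and, subject to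
that, the product of bundle sizes over agents with nonempty bundle. -/
def DichOptimal [Fintype N] [DecidableEq G] (Bset O : N → Finset G) : Prop :=
  IsNonWasteful Bset O ∧
    ∀ O' : N → Finset G, IsNonWasteful Bset O' →
      ((Finset.univ.filter fun i => O' i ≠ ∅).card ≤
        (Finset.univ.filter fun i => O i ≠ ∅).card) ∧
      ((Finset.univ.filter fun i => O' i ≠ ∅).card =
          (Finset.univ.filter fun i => O i ≠ ∅).card →
        ∏ i ∈ Finset.univ.filter fun i => O' i ≠ ∅, (O' i).card ≤
          ∏ i ∈ Finset.univ.filter fun i => O i ≠ ∅, (O i).card)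

/-- `Ostar` maximizes the Nash product over all allocations and, among Nash-product
maximizers, maximizes `∑ i, |O i ∩ Ostar i|` (it is sum-closest to `O`). -/
def NashOptimalClosest [Fintype N] [Fintype G] [DecidableEq G]
    (Bset : N → Finset G) (v : ℚ) (O Ostar : N → Finset G) : Prop :=
  IsAllocation Ostar ∧
    (∀ A : N → Finset G, IsAllocation A → nashProd Bset v A ≤ nashProd Bset v Ostar) ∧
    (∀ A : N → Finset G, IsAllocation A → nashProd Bset v A = nashProd Bset v Ostar →
      ∑ i, (O i ∩ A i).card ≤ ∑ i, (O i ∩ Ostar i).card)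

/-- There is a trail (with pairwise distinct goods) from `i` to `j` in the transformation graph
`G_{X → Y}` all of whose goods are big for their owner in `X`. -/
def ExistsBigTrail (X Y Bset : N → Finset G) (i j : N) : Prop :=
  ∃ (k : ℕ) (ag : ℕ → N) (gd : ℕ → G), ag 0 = i ∧ ag k = j ∧
    (∀ s < k, ∀ t < k, gd s = gd t → s = t) ∧
    ∀ t < k, gd t ∈ X (ag t) ∧ gd t ∈ Y (ag (t + 1)) ∧ gd t ∈ Bset (ag t)

theorem eq_of_mem_of_pairwiseDisjoint {X : N → Finset G}
    (hX : (Set.univ : Set N).PairwiseDisjoint X) {a c : N} {g : G}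
    (ha : g ∈ X a) (hc : g ∈ X c) : a = c := by
  by_contra h
  exact Finset.disjoint_left.1 (hX (Set.mem_univ a) (Set.mem_univ c) h) ha hc

theorem ExistsBigTrail.step {X Y Bset : N → Finset G}
    (hY : (Set.univ : Set N).PairwiseDisjoint Y) {i a c : N} {g : G}
    (h : ExistsBigTrail X Y Bset i a) (hgX : g ∈ X a) (hgB : g ∈ Bset a) (hgY : g ∈ Y c) :
    ExistsBigTrail X Y Bset i c := by
  obtain ⟨k, ag, gd, h0, hk, hinj, hp⟩ := h
  by_cases hg : ∃ t < k, gd t = g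
  · obtain ⟨t, ht, rfl⟩ := hg
    refine ⟨t + 1, ag, gd, h0, eq_of_mem_of_pairwiseDisjoint hY (hp t ht).2.1 hgY, ?_, ?_⟩
    · exact fun s hs u hu => hinj s (by omega) u (by omega)
    · exact fun s hs => hp s (by omega)
  · push Not at hg
    refine ⟨k + 1, fun t => if t ≤ k then ag t else c, fun t => if t < k then gd t else g,
      by simpa using h0, by simp, ?_, ?_⟩
    · intro s hs t ht hst
      by_cases hsk : s < k <;> by_cases htk : t < k <;>
        simp only [hsk, htk, if_true, if_false] at hst
      · exact hinj s hsk t htk hst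
      · exact absurd hst (hg s hsk)
      · exact absurd hst.symm (hg t htk)
      · omega
    · intro t ht
      by_cases htk : t < k
      · have h1 : t ≤ k := by omega
        have h2 : t + 1 ≤ k := by omega
        simpa only [htk, h1, h2, if_true] using hp t htk
      · obtain rfl : t = k := by omega
        simp [hk, hgX, hgB, hgY]

theorem ExistsBigTrail.existsBBPath [DecidableEq G] {X Y Bset : N → Finset G}
    (hYB : ∀ c, Y c ⊆ Bset c) {i j : N} (hij : i ≠ j) (h : ExistsBigTrail X Y Bset i j) :
    ExistsBBPath X Y Bset i j := by
  obtain ⟨k, ag, gd, h0, hk, hinj, hp⟩ := h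
  have hk1 : 1 ≤ k := by
    rcases Nat.eq_zero_or_pos k with rfl | h
    · exact absurd (h0.symm.trans hk) hij
    · exact h
  refine ⟨k, hk1, fun t => ag t, fun t => gd t, ?_, by simpa using h0, by simpa using hk, ?_, ?_,
    ?_, ?_⟩
  · exact fun s t hst => Fin.ext (hinj s s.2 t t.2 hst)
  · exact fun t => ⟨(hp t t.2).1, by simpa using (hp t t.2).2.1⟩
  · intro t ht
    have h1 := (hp (t - 1) (by omega)).2.1
    rw [Nat.sub_add_cancel ht] at h1
    exact iff_of_true (hp t t.2).2.2 (hYB _ h1)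
  · simpa [h0] using (hp 0 hk1).2.2
  · have h1 := (hp (k - 1) (by omega)).2.1
    rw [Nat.sub_add_cancel hk1, hk] at h1
    exact hYB _ h1

/-- The goods of a BB-balancing path into a non-wasteful family are big for both their owners,
and every agent receives as many of them as it gives, except at the two ends of the path. -/
theorem ExistsBBPath.exists_goods [DecidableEq N] [DecidableEq G] {X Y Bset : N → Finset G}
    (hX : (Set.univ : Set N).PairwiseDisjoint X) (hY : (Set.univ : Set N).PairwiseDisjoint Y)
    (hYB : ∀ c, Y c ⊆ Bset c) {i j : N} (h : ExistsBBPath X Y Bset i j) :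
    ∃ P : Finset G, (∀ g ∈ P, ∃ c, g ∈ X c) ∧ (∀ g ∈ P, ∃ c, g ∈ Y c) ∧
      (∀ c, P ∩ X c ⊆ Bset c) ∧
      ∀ c, (P ∩ X c).card + (if j = c then 1 else 0) =
        (P ∩ Y c).card + (if i = c then 1 else 0) := by
  obtain ⟨k, hk, ag, gd, hinj, h0, hl, hp, hbal, hB, -⟩ := h
  have hbig : ∀ t : Fin k, gd t ∈ Bset (ag t.castSucc) := by
    intro t
    by_cases ht : 1 ≤ t.val
    · refine (hbal t ht).2 (hYB _ ?_)
      convert (hp ⟨t.val - 1, by omega⟩).2 using 3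
      ext
      simp
      omega
    · have ht0 : t = ⟨0, hk⟩ := Fin.ext (by simp; omega)
      have hc : t.castSucc = 0 := by rw [ht0]; rfl
      rw [hc, h0, ht0]
      exact hB
  have hXi : ∀ c, Finset.univ.image gd ∩ X c =
      (Finset.univ.filter fun t : Fin k => ag t.castSucc = c).image gd := by
    intro c
    ext g
    simp only [mem_inter, mem_image, mem_univ, true_and, mem_filter]
    constructor
    · rintro ⟨⟨t, rfl⟩, hg⟩
      exact ⟨t, eq_of_mem_of_pairwiseDisjoint hX (hp t).1 hg, rfl⟩
    · rintro ⟨t, rfl, rfl⟩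
      exact ⟨⟨t, rfl⟩, (hp t).1⟩
  have hYi : ∀ c, Finset.univ.image gd ∩ Y c =
      (Finset.univ.filter fun t : Fin k => ag t.succ = c).image gd := by
    intro c
    ext g
    simp only [mem_inter, mem_image, mem_univ, true_and, mem_filter]
    constructor
    · rintro ⟨⟨t, rfl⟩, hg⟩
      exact ⟨t, eq_of_mem_of_pairwiseDisjoint hY (hp t).2 hg, rfl⟩
    · rintro ⟨t, rfl, rfl⟩
      exact ⟨⟨t, rfl⟩, (hp t).2⟩
  refine ⟨Finset.univ.image gd, ?_, ?_, ?_, ?_⟩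
  · simp only [mem_image, mem_univ, true_and, forall_exists_index, forall_apply_eq_imp_iff]
    exact fun t => ⟨_, (hp t).1⟩
  · simp only [mem_image, mem_univ, true_and, forall_exists_index, forall_apply_eq_imp_iff]
    exact fun t => ⟨_, (hp t).2⟩
  · intro c g hg
    rw [hXi] at hg
    simp only [mem_image, mem_filter, mem_univ, true_and] at hg
    obtain ⟨t, rfl, rfl⟩ := hg
    exact hbig t
  · intro c
    rw [hXi, hYi, card_image_of_injective _ hinj, card_image_of_injective _ hinj, card_filter,
      card_filter]
    have h1 := Fin.sum_univ_castSucc fun t : Fin (k + 1) => if ag t = c then 1 else 0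
    have h2 := Fin.sum_univ_succ fun t : Fin (k + 1) => if ag t = c then 1 else 0
    rw [hl] at h1
    rw [h0] at h2
    omega

/-- The family obtained from `X` by handing every good of `P` to its owner in `Y`. -/
def transferGoods [DecidableEq G] (P : Finset G) (X Y : N → Finset G) (c : N) : Finset G :=
  (X c \ P) ∪ (P ∩ Y c)

section transferGoods

variable [DecidableEq G] {P : Finset G} {X Y Bset : N → Finset G}

theorem mem_transferGoods {c : N} {g : G} :
    g ∈ transferGoods P X Y c ↔ (g ∈ X c ∧ g ∉ P) ∨ (g ∈ P ∧ g ∈ Y c) := by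
  simp [transferGoods]

theorem pairwiseDisjoint_transferGoods
    (hX : (Set.univ : Set N).PairwiseDisjoint X) (hY : (Set.univ : Set N).PairwiseDisjoint Y) :
    (Set.univ : Set N).PairwiseDisjoint (transferGoods P X Y) := by
  intro a _ c _ hac
  refine Finset.disjoint_left.2 fun g ha hc => hac ?_
  rw [mem_transferGoods] at ha hc
  rcases ha with ha | ha <;> rcases hc with hc | hc
  · exact eq_of_mem_of_pairwiseDisjoint hX ha.1 hc.1
  · exact absurd hc.1 ha.2
  · exact absurd ha.1 hc.2
  · exact eq_of_mem_of_pairwiseDisjoint hY ha.2 hc.2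

theorem biUnion_transferGoods [Fintype N]
    (hPX : ∀ g ∈ P, ∃ c, g ∈ X c) (hPY : ∀ g ∈ P, ∃ c, g ∈ Y c) :
    Finset.univ.biUnion (transferGoods P X Y) = Finset.univ.biUnion X := by
  ext g
  simp only [mem_biUnion, mem_univ, true_and, mem_transferGoods]
  constructor
  · rintro ⟨c, h | h⟩
    · exact ⟨c, h.1⟩
    · exact hPX g h.1
  · rintro ⟨c, h⟩
    by_cases hg : g ∈ P
    · obtain ⟨d, hd⟩ := hPY g hg
      exact ⟨d, Or.inr ⟨hg, hd⟩⟩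
    · exact ⟨c, Or.inl ⟨h, hg⟩⟩

theorem card_transferGoods_inter (hX : ∀ c, P ∩ X c ⊆ Bset c) (hY : ∀ c, P ∩ Y c ⊆ Bset c)
    (c : N) : (transferGoods P X Y c ∩ Bset c).card + (P ∩ X c).card =
      (X c ∩ Bset c).card + (P ∩ Y c).card := by
  have h1 : transferGoods P X Y c ∩ Bset c = ((X c ∩ Bset c) \ (P ∩ X c)) ∪ (P ∩ Y c) := by
    ext g
    have := @hY c g
    simp only [mem_inter, mem_transferGoods, mem_union, mem_sdiff] at *
    tauto
  have h2 : Disjoint ((X c ∩ Bset c) \ (P ∩ X c)) (P ∩ Y c) := by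
    refine Finset.disjoint_left.2 fun g hg hg' => ?_
    simp only [mem_inter, mem_sdiff] at *
    tauto
  have h3 : P ∩ X c ⊆ X c ∩ Bset c := subset_inter inter_subset_right (hX c)
  have h4 := card_sdiff_add_card_eq_card h3
  rw [h1, card_union_of_disjoint h2]
  omega

theorem transferGoods_sdiff (hX : ∀ c, P ∩ X c ⊆ Bset c) (hY : ∀ c, P ∩ Y c ⊆ Bset c)
    (c : N) : transferGoods P X Y c \ Bset c = X c \ Bset c := by
  ext g
  have h1 := @hY c g
  have h2 := @hX c g
  simp only [mem_inter, mem_transferGoods, mem_sdiff] at *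
  tauto

theorem inter_subset_inter_transferGoods (c : N) :
    Y c ∩ X c ⊆ Y c ∩ transferGoods P X Y c := by
  intro g
  simp only [mem_inter, mem_transferGoods]
  tauto

end transferGoods

theorem prod_eq_mul_mul_prod_erase {M : Type*} [CommMonoid M] [DecidableEq N] {s : Finset N}
    {i j : N} (hij : i ≠ j) (hi : i ∈ s) (hj : j ∈ s) (f : N → M) :
    ∏ c ∈ s, f c = f i * f j * ∏ c ∈ (s.erase i).erase j, f c := by
  rw [← mul_prod_erase s f hi, ← mul_prod_erase (s.erase i) f (mem_erase.2 ⟨hij.symm, hj⟩),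
    mul_assoc]

/-- In a dichotomous optimum, no change by one good of the sizes of two bundles that makes them
more balanced is possible within the non-wasteful allocations. -/
theorem DichOptimal.card_le_card_add_one [Fintype N] [DecidableEq N] [DecidableEq G]
    {Bset O O' : N → Finset G} (hO : DichOptimal Bset O) (hO' : IsNonWasteful Bset O') {i j : N}
    (hij : i ≠ j)
    (hcard : ∀ c, (O' c).card + (if j = c then 1 else 0) =
      (O c).card + (if i = c then 1 else 0)) :
    (O j).card ≤ (O i).card + 1 := by
  by_contra! hlt
  obtain ⟨hle, hprod⟩ := hO.2 O' hO'
  have hi' : (O' i).card = (O i).card + 1 := by simpa [hij.symm] using hcard i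
  have hj' : (O' j).card + 1 = (O j).card := by simpa [hij] using hcard j
  have hc' : ∀ c, c ≠ i → c ≠ j → (O' c).card = (O c).card := fun c hci hcj => by
    simpa [hci.symm, hcj.symm] using hcard c
  have hne : ∀ c, c ≠ i → (O' c ≠ ∅ ↔ O c ≠ ∅) := by
    intro c hci
    simp only [← nonempty_iff_ne_empty, ← card_pos]
    by_cases hcj : c = j
    · subst hcj
      omega
    · rw [hc' c hci hcj]
  have hine : O' i ≠ ∅ := by
    rw [← nonempty_iff_ne_empty, ← card_pos]
    omega
  have hjne : O j ≠ ∅ := by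
    rw [← nonempty_iff_ne_empty, ← card_pos]
    omega
  by_cases hOi : O i = ∅
  · refine absurd hle (not_le.2 (card_lt_card ((ssubset_iff_of_subset fun c hc => ?_).2
      ⟨i, by simpa using hine, by simpa using hOi⟩)))
    simp only [mem_filter, mem_univ, true_and] at hc ⊢
    exact (hne c (by rintro rfl; exact hc hOi)).2 hc
  · have hfilter : (Finset.univ.filter fun c => O' c ≠ ∅) =
        Finset.univ.filter fun c => O c ≠ ∅ := by
      refine filter_congr fun c _ => ?_
      by_cases hci : c = i
      · subst hci
        exact iff_of_true hine hOi
      · exact hne c hci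
    have hle' := hprod (by rw [hfilter])
    rw [hfilter] at hle'
    have his : i ∈ Finset.univ.filter fun c => O c ≠ ∅ := by simpa using hOi
    have hjs : j ∈ Finset.univ.filter fun c => O c ≠ ∅ := by simpa using hjne
    rw [prod_eq_mul_mul_prod_erase hij his hjs, prod_eq_mul_mul_prod_erase hij his hjs,
      prod_congr rfl fun c hc => hc' c (mem_erase.1 (mem_erase.1 hc).2).1 (mem_erase.1 hc).1]
      at hle'
    have hpos : 0 < ∏ c ∈ ((Finset.univ.filter fun c => O c ≠ ∅).erase i).erase j,
        (O c).card := by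
      refine prod_pos fun c hc => card_pos.2 (nonempty_iff_ne_empty.2 ?_)
      exact (mem_filter.1 (mem_erase.1 (mem_erase.1 hc).2).2).2
    have hmul := Nat.le_of_mul_le_mul_right hle' hpos
    rw [hi', ← hj'] at hmul
    nlinarith

theorem twoVal_nonneg [DecidableEq G] (Bset : N → Finset G) {v : ℚ} (hv : 0 ≤ v) (c : N)
    (A : Finset G) : 0 ≤ twoVal Bset v c A := by
  unfold twoVal
  positivity

/-- An allocation strictly closer to `O` than `Ostar` that moves one unit of value from `i` to `j`
has a smaller Nash product, so the values of `i` and `j` in `Ostar` are nearly balanced. -/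
theorem NashOptimalClosest.twoVal_lt_add_one [Fintype N] [DecidableEq N] [Fintype G]
    [DecidableEq G] {Bset O Ostar A : N → Finset G} {v : ℚ} (hv : 0 ≤ v)
    (h : NashOptimalClosest Bset v O Ostar) (hA : IsAllocation A)
    (hcloser : ∑ c, (O c ∩ Ostar c).card < ∑ c, (O c ∩ A c).card) {i j : N} (hij : i ≠ j)
    (hval : ∀ c, twoVal Bset v c (A c) + (if i = c then 1 else 0) =
      twoVal Bset v c (Ostar c) + (if j = c then 1 else 0)) :
    twoVal Bset v i (Ostar i) < twoVal Bset v j (Ostar j) + 1 := by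
  have hlt : nashProd Bset v A < nashProd Bset v Ostar :=
    lt_of_le_of_ne (h.2.1 A hA) fun heq => absurd (h.2.2 A hA heq) (not_le.2 hcloser)
  have hi' : twoVal Bset v i (A i) + 1 = twoVal Bset v i (Ostar i) := by
    simpa [hij.symm] using hval i
  have hj' : twoVal Bset v j (A j) = twoVal Bset v j (Ostar j) + 1 := by
    simpa [hij] using hval j
  unfold nashProd at hlt
  rw [prod_eq_mul_mul_prod_erase hij (mem_univ i) (mem_univ j),
    prod_eq_mul_mul_prod_erase hij (mem_univ i) (mem_univ j)
      fun c => twoVal Bset v c (Ostar c),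
    prod_congr rfl fun c hc => (show twoVal Bset v c (A c) = twoVal Bset v c (Ostar c) by
      simpa [(mem_erase.1 hc).1.symm, (mem_erase.1 (mem_erase.1 hc).2).1.symm] using hval c)]
    at hlt
  have hmul := lt_of_mul_lt_mul_right hlt
    (prod_nonneg fun c _ => twoVal_nonneg Bset hv c (Ostar c))
  rw [hj', ← hi'] at hmul
  linarith

/-- If `i` holds more big goods in `X` than in the non-wasteful allocation `Y`, then a big trail
leads from `i` to an agent that holds fewer. -/
theorem exists_bigTrail_of_card_lt [Fintype N] [DecidableEq G] {X Y Bset : N → Finset G}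
    (hX : (Set.univ : Set N).PairwiseDisjoint X) (hY : IsNonWasteful Bset Y) {i : N}
    (hi : (Y i ∩ Bset i).card < (X i ∩ Bset i).card) :
    ∃ j, (X j ∩ Bset j).card < (Y j ∩ Bset j).card ∧ ExistsBigTrail X Y Bset i j := by
  classical
  obtain ⟨hYd, hYB, hYU⟩ := hY
  by_contra! hno
  let R := Finset.univ.filter fun c => ExistsBigTrail X Y Bset i c
  obtain ⟨g₀, -⟩ : (X i ∩ Bset i).Nonempty := card_pos.1 (by omega)
  have hiR : i ∈ R := by
    simp only [R, mem_filter, mem_univ, true_and]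
    exact ⟨0, fun _ => i, fun _ => g₀, rfl, rfl, by simp, by simp⟩
  have hlt : ∑ c ∈ R, (Y c ∩ Bset c).card < ∑ c ∈ R, (X c ∩ Bset c).card := by
    refine sum_lt_sum (fun c hc => ?_) ⟨i, hiR, hi⟩
    by_contra! hlt
    exact hno c hlt (mem_filter.1 hc).2
  rw [← card_biUnion fun a _ c _ hac => (hYd (Set.mem_univ a) (Set.mem_univ c) hac).mono
      inter_subset_left inter_subset_left,
    ← card_biUnion fun a _ c _ hac => (hX (Set.mem_univ a) (Set.mem_univ c) hac).mono
      inter_subset_left inter_subset_left] at hlt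
  refine absurd (card_le_card fun g hg => ?_) (not_le.2 hlt)
  simp only [R, mem_biUnion, mem_filter, mem_univ, true_and, mem_inter] at hg ⊢
  obtain ⟨a, ha, hgX, hgB⟩ := hg
  have hgU : g ∈ Finset.univ.biUnion Y := by
    rw [hYU]
    exact mem_biUnion.2 ⟨a, mem_univ a, hgB⟩
  obtain ⟨c, -, hgY⟩ := mem_biUnion.1 hgU
  exact ⟨c, ha.step hYd hgX hgB hgY, hgY, hYB c hgY⟩

/-- Corollary 3.6: if some agent `i` has `b_i < b*_i`, then some agent `j` with
`b*_j < b_j` is reachable from `i` by a BB-balancing path in `G_{O* → O}`, and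
every such reachable agent `j` has a small good in `O*_j`. -/
theorem stmt4 [Fintype N] [DecidableEq N] [Fintype G] [DecidableEq G]
    (Bset : N → Finset G) (v : ℚ) (hv0 : 0 < v) (hv1 : v < 1)
    (O Ostar : N → Finset G)
    (hO : DichOptimal Bset O) (hOstar : NashOptimalClosest Bset v O Ostar)
    (i : N) (hi : (O i ∩ Bset i).card < (Ostar i ∩ Bset i).card) :
    (∃ j : N, (Ostar j ∩ Bset j).card < (O j ∩ Bset j).card ∧
      ExistsBBPath Ostar O Bset i j) ∧
    (∀ j : N, (Ostar j ∩ Bset j).card < (O j ∩ Bset j).card →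
      ExistsBBPath Ostar O Bset i j → (Ostar j \ Bset j).Nonempty) := by
  obtain ⟨hOd, hOB, hOU⟩ := hO.1
  obtain ⟨hSd, hSU⟩ := hOstar.1
  refine ⟨?_, fun j hj hpath => ?_⟩
  · obtain ⟨j, hj, htrail⟩ := exists_bigTrail_of_card_lt hSd hO.1 hi
    refine ⟨j, hj, htrail.existsBBPath hOB ?_⟩
    rintro rfl
    omega
  · by_contra hempty
    have hij : i ≠ j := by
      rintro rfl
      omega
    obtain ⟨P, hPS, hPO, hPB, hcount⟩ := hpath.exists_goods hSd hOd hOB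
    have hPB' : ∀ c, P ∩ O c ⊆ Bset c := fun c => inter_subset_right.trans (hOB c)
    have hO'B : ∀ c, transferGoods P O Ostar c ⊆ Bset c := by
      intro c
      rw [← sdiff_eq_empty_iff_subset, transferGoods_sdiff hPB' hPB, sdiff_eq_empty_iff_subset]
      exact hOB c
    have hbalO : (O j).card ≤ (O i).card + 1 := by
      refine hO.card_le_card_add_one (O' := transferGoods P O Ostar)
        ⟨pairwiseDisjoint_transferGoods hOd hSd, hO'B,
          (biUnion_transferGoods hPO hPS).trans hOU⟩ hij fun c => ?_
      have h1 := card_transferGoods_inter hPB' hPB c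
      have h2 := hcount c
      rw [inter_eq_left.2 (hO'B c), inter_eq_left.2 (hOB c)] at h1
      omega
    have hbalS : twoVal Bset v i (Ostar i) < twoVal Bset v j (Ostar j) + 1 := by
      refine hOstar.twoVal_lt_add_one (A := transferGoods P Ostar O) hv0.le
        ⟨pairwiseDisjoint_transferGoods hSd hOd, (biUnion_transferGoods hPS hPO).trans hSU⟩
        (sum_lt_sum (fun c _ => card_le_card (inter_subset_inter_transferGoods c))
          ⟨j, mem_univ j, card_lt_card ?_⟩) hij fun c => ?_
      · refine ⟨inter_subset_inter_transferGoods j, fun hsub => ?_⟩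
        have hle : (P ∩ O j).card ≤ (P ∩ Ostar j).card := by
          refine card_le_card fun g hg => ?_
          obtain ⟨hgP, hgO⟩ := mem_inter.1 hg
          have := hsub (mem_inter.2 ⟨hgO, mem_transferGoods.2 (Or.inr ⟨hgP, hgO⟩)⟩)
          exact mem_inter.2 ⟨hgP, (mem_inter.1 this).2⟩
        have h2 := hcount j
        simp only [hij, if_true, if_false] at h2
        omega
      · have h1 := card_transferGoods_inter hPB hPB' c
        have h2 := hcount c
        have h3 : (transferGoods P Ostar O c ∩ Bset c).card + (if i = c then 1 else 0) =
            (Ostar c ∩ Bset c).card + (if j = c then 1 else 0) := by omega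
        have h4 : ((transferGoods P Ostar O c ∩ Bset c).card : ℚ) + (if i = c then 1 else 0) =
            (Ostar c ∩ Bset c).card + (if j = c then 1 else 0) := by exact_mod_cast h3
        unfold twoVal
        rw [transferGoods_sdiff hPB hPB']
        linarith
    rw [not_nonempty_iff_eq_empty] at hempty
    simp only [twoVal, hempty, card_empty, Nat.cast_zero, mul_zero, add_zero] at hbalS
    have hsmall : 0 ≤ v * ((Ostar i \ Bset i).card : ℚ) := by positivity
    have hbig : ((Ostar i ∩ Bset i).card : ℚ) < ((Ostar j ∩ Bset j).card + 1 : ℕ) := by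
      push_cast
      linarith
    have hbig' : (Ostar i ∩ Bset i).card < (Ostar j ∩ Bset j).card + 1 := by exact_mod_cast hbig
    rw [inter_eq_left.2 (hOB i)] at hi
    rw [inter_eq_left.2 (hOB j)] at hj
    omega
end
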